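/- Let L be a field, V a finite-dimensional L-vector space, and φ : V → V an L-linear endomorphism. Let ⊥ = W_{-1} ≤ W_0 ≤ ⋯ ≤ W_n = ⊤ and ⊥ = W'_{-1} ≤ W'_0 ≤ ⋯ ≤ W'_n = ⊤ be two chains of φ-invariant subspaces of V. Let P_k (resp. P'_j) be the characteristic polynomial of the endomorphism induced by φ on W_k/W_{k-1} (resp. on W'_j/W'_{j-1}), and assume P_k and P'_j are coprime in L[X] whenever k ≠ j. Then W_k = W'_k for all k; that is, such a filtration is unique. -/

import Mathlib

/-- The endomorphism induced by `φ` on the graded piece `B ⧸ A` of a pair of nested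
`φ`-invariant subspaces `A ≤ B`. -/
noncomputable def gradedEnd {L V : Type*} [Field L] [AddCommGroup V] [Module L V]
    (φ : V →ₗ[L] V) (A B : Submodule L V)
    (hA : ∀ x ∈ A, φ x ∈ A) (hB : ∀ x ∈ B, φ x ∈ B) :
    (B ⧸ A.comap B.subtype) →ₗ[L] (B ⧸ A.comap B.subtype) :=
  Submodule.mapQ _ _ (φ.restrict hB) (fun x hx => hA x.1 hx)

/-- The characteristic polynomial of the endomorphism induced by `φ` on the graded piece
`B ⧸ A` of a pair of nested `φ`-invariant subspaces `A ≤ B`. -/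
noncomputable def gradedCharpoly {L V : Type*} [Field L] [AddCommGroup V] [Module L V]
    [FiniteDimensional L V] (φ : V →ₗ[L] V) (A B : Submodule L V)
    (hA : ∀ x ∈ A, φ x ∈ A) (hB : ∀ x ∈ B, φ x ∈ B) : Polynomial L :=
  LinearMap.charpoly (gradedEnd φ A B hA hB)

open Polynomial in
/-- A linear map intertwining two endomorphisms intertwines their values at any polynomial. -/
theorem LinearMap.map_aeval_apply_of_intertwines {L M N : Type*} [CommSemiring L]
    [AddCommMonoid M] [Module L M] [AddCommMonoid N] [Module L N]
    {g : M →ₗ[L] M} {h : N →ₗ[L] N} {f : M →ₗ[L] N} (hf : ∀ x, f (g x) = h (f x))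
    (p : L[X]) (x : M) : f (aeval g p x) = aeval h p (f x) := by
  induction p using Polynomial.induction_on generalizing x with
  | C a => simp
  | add p q hp hq => simp [hp, hq]
  | monomial n a ih =>
    rw [pow_succ, ← mul_assoc, map_mul (aeval g), map_mul (aeval h), Module.End.mul_apply,
      Module.End.mul_apply, ih, aeval_X, aeval_X, hf]

open Polynomial in
/-- By Cayley–Hamilton on `B ⧸ A`, the graded characteristic polynomial evaluated at `φ` maps
`B` into `A`. -/
theorem aeval_gradedCharpoly_apply_mem {L V : Type*} [Field L] [AddCommGroup V] [Module L V]
    [FiniteDimensional L V] (φ : V →ₗ[L] V) {A B : Submodule L V}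
    (hA : ∀ x ∈ A, φ x ∈ A) (hB : ∀ x ∈ B, φ x ∈ B) {x : V} (hx : x ∈ B) :
    aeval φ (gradedCharpoly φ A B hA hB) x ∈ A := by
  set p := gradedCharpoly φ A B hA hB with hp
  have hsub : ((aeval (φ.restrict hB) p ⟨x, hx⟩ : B) : V) = aeval φ p x :=
    LinearMap.map_aeval_apply_of_intertwines (f := B.subtype) (fun _ => rfl) p ⟨x, hx⟩
  have hquot : (A.comap B.subtype).mkQ (aeval (φ.restrict hB) p ⟨x, hx⟩) = 0 := by
    rw [LinearMap.map_aeval_apply_of_intertwines (f := (A.comap B.subtype).mkQ)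
      (g := φ.restrict hB) (h := gradedEnd φ A B hA hB) (fun _ => rfl), hp, gradedCharpoly,
      LinearMap.aeval_self_charpoly, LinearMap.zero_apply]
  rw [← hsub]
  simpa using hquot

open Polynomial in
theorem aeval_prod_Ico_apply_mem {L V : Type*} [CommSemiring L] [AddCommMonoid V] [Module L V]
    (φ : V →ₗ[L] V) (W : ℕ → Submodule L V) (P : ℕ → L[X]) {k m : ℕ} (hkm : k ≤ m)
    (hstep : ∀ i < m, ∀ x ∈ W (i + 1), aeval φ (P i) x ∈ W i) :
    ∀ x ∈ W m, aeval φ (∏ i ∈ Finset.Ico k m, P i) x ∈ W k := by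
  induction m, hkm using Nat.le_induction with
  | base => simp
  | succ m hkm ih =>
    intro x hx
    rw [Finset.prod_Ico_succ_top hkm, map_mul, Module.End.mul_apply]
    exact ih (fun i hi => hstep i (hi.trans m.lt_succ_self)) _ (hstep m m.lt_succ_self x hx)

open Polynomial in
theorem filtration_le_of_isCoprime {L V : Type*} [CommSemiring L] [AddCommMonoid V] [Module L V]
    (φ : V →ₗ[L] V) {N : ℕ} {W W' : ℕ → Submodule L V} {P P' : ℕ → L[X]}
    (hbot : W 0 = ⊥) (htop' : W' N = ⊤)
    (hstep : ∀ i < N, ∀ x ∈ W (i + 1), aeval φ (P i) x ∈ W i)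
    (hstep' : ∀ j < N, ∀ x ∈ W' (j + 1), aeval φ (P' j) x ∈ W' j)
    (hcop : ∀ i < N, ∀ j < N, i ≠ j → IsCoprime (P i) (P' j)) {k : ℕ} (hk : k ≤ N) :
    W k ≤ W' k := by
  intro x hx
  have hprod : IsCoprime (∏ i ∈ Finset.Ico 0 k, P i) (∏ j ∈ Finset.Ico k N, P' j) := by
    refine IsCoprime.prod_left fun i hi => IsCoprime.prod_right fun j hj => ?_
    rw [Finset.mem_Ico] at hi hj
    exact hcop i (by lia) j hj.2 (by lia)
  obtain ⟨a, b, hab⟩ := hprod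
  have hker : aeval φ (∏ i ∈ Finset.Ico 0 k, P i) x = 0 := by
    simpa [hbot] using
      aeval_prod_Ico_apply_mem φ W P k.zero_le (fun i hi => hstep i (hi.trans_le hk)) x hx
  have hdecomp : x = aeval φ (∏ j ∈ Finset.Ico k N, P' j) (aeval φ b x) := by
    have h := congrArg (fun q => aeval φ q x) hab
    rw [mul_comm b] at h
    simpa only [map_add, map_mul, map_one, LinearMap.add_apply, Module.End.mul_apply,
      Module.End.one_apply, hker, map_zero, zero_add] using h.symm
  rw [hdecomp]
  exact aeval_prod_Ico_apply_mem φ W' P' hk hstep' _ (htop' ▸ Submodule.mem_top)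

/-- Uniqueness of the filtration: two filtrations `⊥ = W₋₁ ≤ W₀ ≤ ⋯ ≤ Wₙ = ⊤` and
`⊥ = W'₋₁ ≤ W'₀ ≤ ⋯ ≤ W'ₙ = ⊤` of the same space by `φ`-invariant subspaces, whose graded
characteristic polynomials in distinct degrees are coprime, coincide. (The filtrations are
encoded with an index shift, so that `W k` denotes `W_{k-1}`.) -/
theorem filtration_unique_of_coprime_gradedCharpoly
    {L V : Type*} [Field L] [AddCommGroup V] [Module L V] [FiniteDimensional L V]
    (φ : V →ₗ[L] V) (n : ℕ) (W W' : ℕ → Submodule L V)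
    (hbot : W 0 = ⊥) (htop : W (n + 1) = ⊤) (hmono : Monotone W)
    (hbot' : W' 0 = ⊥) (htop' : W' (n + 1) = ⊤) (hmono' : Monotone W')
    (hinv : ∀ k, ∀ x ∈ W k, φ x ∈ W k) (hinv' : ∀ k, ∀ x ∈ W' k, φ x ∈ W' k)
    (P P' : ℕ → Polynomial L)
    (hP : ∀ k ≤ n, P k = gradedCharpoly φ (W k) (W (k + 1)) (hinv k) (hinv (k + 1)))
    (hP' : ∀ j ≤ n, P' j = gradedCharpoly φ (W' j) (W' (j + 1)) (hinv' j) (hinv' (j + 1)))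
    (hcop : ∀ k ≤ n, ∀ j ≤ n, k ≠ j → IsCoprime (P k) (P' j)) :
    ∀ k ≤ n, W (k + 1) = W' (k + 1) := by
  have hstep : ∀ i < n + 1, ∀ x ∈ W (i + 1), Polynomial.aeval φ (P i) x ∈ W i := by
    intro i hi x hx
    rw [hP i (Nat.le_of_lt_succ hi)]
    exact aeval_gradedCharpoly_apply_mem φ _ _ hx
  have hstep' : ∀ j < n + 1, ∀ x ∈ W' (j + 1), Polynomial.aeval φ (P' j) x ∈ W' j := by
    intro j hj x hx
    rw [hP' j (Nat.le_of_lt_succ hj)]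
    exact aeval_gradedCharpoly_apply_mem φ _ _ hx
  intro k hk
  apply le_antisymm
  · exact filtration_le_of_isCoprime φ hbot htop' hstep hstep'
      (fun i hi j hj hij => hcop i (by lia) j (by lia) hij) (Nat.succ_le_succ hk)
  · exact filtration_le_of_isCoprime φ hbot' htop hstep' hstep
      (fun i hi j hj hij => (hcop j (by lia) i (by lia) hij.symm).symm) (Nat.succ_le_succ hk)
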